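/- Let P = ℝ[x_{μν} : 1 ≤ μ < ν ≤ n] with x_{νμ} := -x_{μν}, x_{μμ} := 0, multiplication operators x_{αβ} and partial derivative operators ∂_{μν} (∂_{νμ} = -∂_{μν}), and let K, its powers (-K)^{k}, and the locally finite operator sums be as induced by K_{(μν)(αβ)} = (1/2)(δ_{μα}∂_{νβ} - δ_{μβ}∂_{να} + δ_{νβ}∂_{μα} - δ_{να}∂_{μβ}). Let ∂ denote the n×n matrix of operators [∂_{μν}] and (e^∂)_{ρσ} = Σ_{m≥0} (1/m!)(∂^m)_{ρσ} its entrywise matrix exponential (a well-defined operator on P by local nilpotency). Then for all α,β,ρ,σ: [x_{αβ}, (e^∂)_{ρσ}] = 2 Σ_{μ=1}^n Σ_{k≥1} (1/k!) ((-K)^{k-1})_{(αβ)(μρ)} ∘ (e^∂)_{μσ}. -/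

import Mathlib

open MvPolynomial

/-- Index set for the variables `x_{μν}`, `1 ≤ μ < ν ≤ n`. -/
abbrev PairIdx (n : ℕ) := {q : Fin n × Fin n // q.1 < q.2}

/-- The polynomial algebra `P = ℝ[x_{μν} : 1 ≤ μ < ν ≤ n]`. -/
abbrev PolyH (n : ℕ) := MvPolynomial (PairIdx n) ℝ

/-- Kronecker delta. -/
def kd {n : ℕ} (a b : Fin n) : ℝ := if a = b then 1 else 0

/-- The antisymmetric family of variables: `x_{νμ} = -x_{μν}`, `x_{μμ} = 0`. -/
noncomputable def xv {n : ℕ} (μ ν : Fin n) : PolyH n :=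
  if h : μ < ν then X ⟨(μ, ν), h⟩ else if h : ν < μ then - X ⟨(ν, μ), h⟩ else 0

/-- Multiplication operator by `x_{μν}`. -/
noncomputable def xop {n : ℕ} (μ ν : Fin n) : PolyH n → PolyH n := fun p => xv μ ν * p

/-- Partial differentiation `∂_{μν}`, antisymmetric: `∂_{νμ} = -∂_{μν}`. -/
noncomputable def dop {n : ℕ} (μ ν : Fin n) : PolyH n → PolyH n := fun p =>
  if h : μ < ν then pderiv ⟨(μ, ν), h⟩ p else if h : ν < μ then - pderiv ⟨(ν, μ), h⟩ p else 0

/-- `K_{(μν)(αβ)} = (1/2)(δ_{μα}∂_{νβ} - δ_{μβ}∂_{να} + δ_{νβ}∂_{μα} - δ_{να}∂_{μβ})`. -/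
noncomputable def Kop {n : ℕ} (μ ν α β : Fin n) : PolyH n → PolyH n := fun p =>
  (1/2 : ℝ) • (kd μ α • dop ν β p - kd μ β • dop ν α p + kd ν β • dop μ α p - kd ν α • dop μ β p)

/-- Powers of `-K`: `((-K)⁰)_{(μν)(αβ)} = (1/2)(δ_{μα}δ_{νβ} - δ_{μβ}δ_{να})·id` and
`((-K)^m)_{(μν)(αβ)} = Σ_{θ,σ} (-K_{(μν)(θσ)})((-K)^{m-1})_{(θσ)(αβ)}`. -/
noncomputable def negKpow {n : ℕ} : ℕ → Fin n → Fin n → Fin n → Fin n → (PolyH n → PolyH n)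
  | 0 => fun μ ν α β p => ((1/2 : ℝ) * (kd μ α * kd ν β - kd μ β * kd ν α)) • p
  | m+1 => fun μ ν α β p => ∑ θ, ∑ σ, - Kop μ ν θ σ (negKpow m θ σ α β p)

/-- Ordinary matrix powers of the `n×n` matrix of operators `∂ = [∂_{μν}]`
(`∂⁰` the identity matrix). -/
noncomputable def dmatpow {n : ℕ} : ℕ → Fin n → Fin n → (PolyH n → PolyH n)
  | 0 => fun μ ν p => kd μ ν • p
  | m+1 => fun μ ν p => ∑ α, dmatpow m μ α (dop α ν p)

/-- The entrywise matrix exponential `(e^∂)_{μν} = Σ_{m≥0} (1/m!)(∂^m)_{μν}`,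
a locally finite sum. -/
noncomputable def expD {n : ℕ} (μ ν : Fin n) : PolyH n → PolyH n := fun p =>
  ∑ᶠ m : ℕ, ((m.factorial : ℝ))⁻¹ • dmatpow m μ ν p

section RingIdentities

variable {R A : Type*} [CommRing R] [Ring A] [Algebra R A]

variable (R) in
/-- The inner derivation `a ↦ D * a - a * D`. -/
def innerAd (D : A) : Module.End R A := LinearMap.mulLeft R D - LinearMap.mulRight R D

theorem innerAd_apply (D a : A) : innerAd R D a = D * a - a * D := rfl

theorem innerAd_pow_mul_of_commute {D s : A} (h : Commute s D) (k : ℕ) (a : A) :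
    (innerAd R D ^ k) (s * a) = s * (innerAd R D ^ k) a := by
  induction k with
  | zero => simp
  | succ k ih =>
    rw [pow_succ', Module.End.mul_apply, Module.End.mul_apply, ih, innerAd_apply, innerAd_apply,
      mul_sub, ← mul_assoc, ← h.eq, mul_assoc, mul_assoc]

theorem pow_mul_eq_sum_innerAd (D a : A) (N : ℕ) :
    D ^ N * a = ∑ k ∈ Finset.range (N + 1), N.choose k • ((innerAd R D ^ k) a * D ^ (N - k)) := by
  have hc : Commute (innerAd R D) (LinearMap.mulRight R D) :=
    (LinearMap.commute_mulLeft_right D D).sub_left (Commute.refl _)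
  have hL : LinearMap.mulLeft R D = innerAd R D + LinearMap.mulRight R D := by simp [innerAd]
  rw [← LinearMap.mulLeft_apply (R := R), ← LinearMap.pow_mulLeft, hL, hc.add_pow,
    LinearMap.sum_apply]
  refine Finset.sum_congr rfl fun k _ => ?_
  rw [(hc.pow_pow k (N - k)).eq, ← nsmul_eq_mul', LinearMap.smul_apply, Module.End.mul_apply,
    LinearMap.pow_mulRight, LinearMap.mulRight_apply]

theorem pow_succ_commutator_eq_sum_innerAd (D X : A) (N : ℕ) :
    D ^ (N + 1) * X - X * D ^ (N + 1) = ∑ k ∈ Finset.range (N + 1),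
      (N + 1).choose (k + 1) • ((innerAd R D ^ k) (D * X - X * D) * D ^ (N - k)) := by
  induction N with
  | zero => simp
  | succ N ih =>
    have hstep : D ^ (N + 2) * X - X * D ^ (N + 2) =
        (D ^ (N + 1) * X - X * D ^ (N + 1)) * D + D ^ (N + 1) * (D * X - X * D) := by
      simp only [pow_succ]
      noncomm_ring
    have htop : ∑ k ∈ Finset.range (N + 1), (N + 1).choose (k + 1) •
          ((innerAd R D ^ k) (D * X - X * D) * D ^ (N - k)) * D =
        ∑ k ∈ Finset.range (N + 2), (N + 1).choose (k + 1) •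
          ((innerAd R D ^ k) (D * X - X * D) * D ^ (N + 1 - k)) := by
      rw [Finset.sum_range_succ _ (N + 1)]
      simp only [Nat.choose_succ_self, zero_smul, add_zero]
      refine Finset.sum_congr rfl fun k hk => ?_
      have hk' : N + 1 - k = N - k + 1 := by have := Finset.mem_range.1 hk; omega
      rw [hk', pow_succ, smul_mul_assoc, mul_assoc]
    rw [hstep, ih, Finset.sum_mul, htop, pow_mul_eq_sum_innerAd (R := R), ← Finset.sum_add_distrib]
    refine Finset.sum_congr rfl fun k _ => ?_
    rw [← add_smul, Nat.choose_succ_succ (N + 1) k, add_comm]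

end RingIdentities

/-- Triangular resummation of a double sum that vanishes above the diagonal. -/
theorem sum_range_antidiagonal_eq_of_vanishing {M : Type*} [AddCommMonoid M] (n : ℕ)
    (f : ℕ → ℕ → M) (hf : ∀ k l, n ≤ k + l → f k l = 0) :
    ∑ m ∈ Finset.range n, ∑ k ∈ Finset.range (m + 1), f k (m - k) =
      ∑ k ∈ Finset.range n, ∑ l ∈ Finset.range n, f k l := by
  rw [Finset.sum_range_diag_flip]
  refine Finset.sum_congr rfl fun k _ => ?_
  refine Finset.sum_subset (Finset.range_mono (Nat.sub_le n k)) fun l _ hl => hf k l ?_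
  rw [Finset.mem_range] at hl
  omega

section LocalNilpotency

variable {τ : Type*}

/-- The polynomials killed by every composite of `d` partial derivatives. -/
noncomputable def pderivFiltration : ℕ → Submodule ℝ (MvPolynomial τ ℝ)
  | 0 => ⊥
  | d + 1 => ⨅ i, (pderivFiltration d).comap (pderiv i).toLinearMap

theorem mem_pderivFiltration_succ {d : ℕ} {p : MvPolynomial τ ℝ} :
    p ∈ pderivFiltration (d + 1) ↔ ∀ i, pderiv i p ∈ pderivFiltration d := by
  simp [pderivFiltration]

theorem pderivFiltration_mono : Monotone (pderivFiltration (τ := τ)) := by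
  refine monotone_nat_of_le_succ fun d => ?_
  induction d with
  | zero => exact bot_le
  | succ d ih =>
    intro p hp
    rw [mem_pderivFiltration_succ] at hp ⊢
    exact fun i => ih (hp i)

theorem X_mul_mem_pderivFiltration (j : τ) {d : ℕ} {p : MvPolynomial τ ℝ}
    (hp : p ∈ pderivFiltration d) : X j * p ∈ pderivFiltration (d + 1) := by
  classical
  induction d generalizing p with
  | zero =>
    obtain rfl : p = 0 := hp
    simp
  | succ d ih =>
    rw [mem_pderivFiltration_succ]
    intro i
    rw [pderiv_mul, pderiv_X]
    refine Submodule.add_mem _ ?_ (ih (mem_pderivFiltration_succ.1 hp i))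
    by_cases hij : j = i
    · subst hij; simpa using hp
    · simp [hij]

theorem exists_mem_pderivFiltration (p : MvPolynomial τ ℝ) : ∃ d, p ∈ pderivFiltration d := by
  induction p using MvPolynomial.induction_on with
  | C a => exact ⟨1, mem_pderivFiltration_succ.2 fun i => by simp⟩
  | add p q hp hq =>
    obtain ⟨d, hd⟩ := hp
    obtain ⟨e, he⟩ := hq
    exact ⟨max d e, Submodule.add_mem _ (pderivFiltration_mono (le_max_left _ _) hd)
      (pderivFiltration_mono (le_max_right _ _) he)⟩
  | mul_X p i hp =>
    obtain ⟨d, hd⟩ := hp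
    exact ⟨d + 1, mul_comm p (X i) ▸ X_mul_mem_pderivFiltration i hd⟩

theorem pderiv_commute (i j : τ) (p : MvPolynomial τ ℝ) :
    pderiv i (pderiv j p) = pderiv j (pderiv i p) := by
  classical
  have h : ⁅(pderiv i : Derivation ℝ (MvPolynomial τ ℝ) (MvPolynomial τ ℝ)),
      (pderiv j : Derivation ℝ (MvPolynomial τ ℝ) (MvPolynomial τ ℝ))⁆ = 0 := by
    refine derivation_ext fun k => ?_
    rw [Derivation.commutator_apply, pderiv_X, pderiv_X]
    simp only [Pi.single_apply]
    split_ifs <;> simp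
  have := congrArg (fun D : Derivation ℝ (MvPolynomial τ ℝ) (MvPolynomial τ ℝ) => D p) h
  rwa [Derivation.commutator_apply, Derivation.zero_apply, sub_eq_zero] at this

end LocalNilpotency

theorem scalar_mul_apply {m S : Type*} [Fintype m] [DecidableEq m] [Semiring S] (a : S)
    (M : Matrix m m S) (i j : m) : (Matrix.scalar m a * M) i j = a * M i j := by
  rw [Matrix.scalar_apply, Matrix.diagonal_mul]

theorem mul_scalar_apply {m S : Type*} [Fintype m] [DecidableEq m] [Semiring S] (a : S)
    (M : Matrix m m S) (i j : m) : (M * Matrix.scalar m a) i j = M i j * a := by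
  rw [Matrix.scalar_apply, Matrix.mul_diagonal]

section Operators

variable {n : ℕ}

/-- `dop` as a linear map. -/
noncomputable def dLin (μ ν : Fin n) : Module.End ℝ (PolyH n) :=
  if h : μ < ν then (pderiv ⟨(μ, ν), h⟩).toLinearMap
  else if h : ν < μ then -(pderiv ⟨(ν, μ), h⟩).toLinearMap else 0

theorem dLin_apply (μ ν : Fin n) (p : PolyH n) : dLin μ ν p = dop μ ν p := by
  unfold dLin dop
  split_ifs <;> rfl

theorem dLin_swap (μ ν : Fin n) : dLin ν μ = -dLin μ ν := by
  unfold dLin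
  rcases lt_trichotomy μ ν with h | rfl | h
  · simp [h, h.not_gt]
  · simp
  · simp [h, h.not_gt]

theorem dLin_commute (μ ν α β : Fin n) : Commute (dLin μ ν) (dLin α β) := by
  have key (i j : PairIdx n) : Commute (S := Module.End ℝ (PolyH n))
      (pderiv i).toLinearMap (pderiv j).toLinearMap :=
    LinearMap.ext fun p => pderiv_commute i j p
  unfold dLin
  split_ifs
  · exact key _ _
  · exact (key _ _).neg_right
  · exact Commute.zero_right _
  · exact (key _ _).neg_left
  · exact (key _ _).neg_left.neg_right
  · exact Commute.zero_right _
  all_goals exact Commute.zero_left _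

/-- The action of `-K` on antisymmetric matrices, written out for an antisymmetric family `D`
of vectors. -/
theorem sum_skew_smul {M : Type*} [AddCommGroup M] [Module ℝ M] (D : Fin n → Fin n → M)
    (hD : ∀ a b, D b a = -D a b) (α β μ ρ : Fin n) :
    ∑ θ, ∑ τ, (kd θ μ * kd τ ρ - kd θ ρ * kd τ μ) • -((1/2 : ℝ) •
        (kd α θ • D β τ - kd α τ • D β θ + kd β τ • D α θ - kd β θ • D α τ)) =
      ∑ j, (kd α j * kd β ρ - kd α ρ * kd β j) • D μ j -
        ∑ j, (kd α μ * kd β j - kd α j * kd β μ) • D j ρ := by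
  have hsum (f : Fin n → Fin n → M) (a b : Fin n) :
      ∑ θ, ∑ τ, (kd θ a * kd τ b) • f θ τ = f a b := by
    simp only [kd, mul_ite, mul_one, mul_zero, ite_smul, one_smul, zero_smul, Finset.sum_ite_eq',
      Finset.mem_univ, if_true]
  have hright (f : Fin n → M) (a : Fin n) (c : ℝ) :
      ∑ θ, (c * kd a θ) • f θ = c • f a := by
    simp [kd]
  have hleft (f : Fin n → M) (a : Fin n) (c : ℝ) :
      ∑ θ, (kd a θ * c) • f θ = c • f a := by
    simp [kd]
  simp only [sub_smul, Finset.sum_sub_distrib, hsum, hright, hleft,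
    mul_comm (kd α ρ) (kd β _), mul_comm (kd α _) (kd β μ)]
  rw [hD μ α, hD μ β]
  module

theorem dLin_commutator_mulLeft (μ ν α β : Fin n) :
    dLin μ ν * LinearMap.mulLeft ℝ (xv α β) - LinearMap.mulLeft ℝ (xv α β) * dLin μ ν =
      (kd α μ * kd β ν - kd α ν * kd β μ) • (1 : Module.End ℝ (PolyH n)) := by
  have hX : dLin μ ν (xv α β) = C (kd α μ * kd β ν - kd α ν * kd β μ) := by
    unfold dLin xv
    split_ifs <;> simp [pderiv_X, Pi.single_apply, kd] <;> grind
  have hL (p q : PolyH n) : dLin μ ν (p * q) = p * dLin μ ν q + dLin μ ν p * q := by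
    unfold dLin
    split_ifs <;> simp <;> ring_nf
  refine LinearMap.ext fun p => ?_
  rw [LinearMap.sub_apply, Module.End.mul_apply, Module.End.mul_apply, LinearMap.mulLeft_apply,
    LinearMap.mulLeft_apply, hL, hX, add_sub_cancel_left, ← smul_eq_C_mul]
  rfl

/-- The matrix `∂` of operators. -/
noncomputable def dMat (n : ℕ) : Matrix (Fin n) (Fin n) (Module.End ℝ (PolyH n)) :=
  Matrix.of dLin

theorem dmatpow_eq (m : ℕ) (μ ν : Fin n) (p : PolyH n) :
    dmatpow m μ ν p = (dMat n ^ m) μ ν p := by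
  induction m generalizing ν p with
  | zero =>
    by_cases h : μ = ν <;> simp [dmatpow, kd, h]
  | succ m ih =>
    simp [dmatpow, pow_succ, Matrix.mul_apply, ih, dMat, dLin_apply]

/-- The elementary antisymmetric matrix with entries `δ_{αμ}δ_{βν} - δ_{αν}δ_{βμ}`. -/
noncomputable def skewUnit (α β : Fin n) : Matrix (Fin n) (Fin n) (Module.End ℝ (PolyH n)) :=
  Matrix.of fun μ ν => (kd α μ * kd β ν - kd α ν * kd β μ) • 1

theorem dMat_commutator_scalar (α β : Fin n) :
    dMat n * Matrix.scalar (Fin n) (LinearMap.mulLeft ℝ (xv α β)) -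
      Matrix.scalar (Fin n) (LinearMap.mulLeft ℝ (xv α β)) * dMat n = skewUnit α β := by
  ext1 μ ν
  rw [Matrix.sub_apply, mul_scalar_apply, scalar_mul_apply]
  exact dLin_commutator_mulLeft μ ν α β

/-- `Kop` as a linear map. -/
noncomputable def kLin (μ ν α β : Fin n) : Module.End ℝ (PolyH n) :=
  (1/2 : ℝ) • (kd μ α • dLin ν β - kd μ β • dLin ν α + kd ν β • dLin μ α - kd ν α • dLin μ β)

theorem kLin_apply (μ ν α β : Fin n) (p : PolyH n) : kLin μ ν α β p = Kop μ ν α β p := by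
  simp [kLin, Kop, dLin_apply]

theorem scalar_kLin_commute_dMat (α β θ τ : Fin n) :
    Commute (Matrix.scalar (Fin n) (-kLin α β θ τ)) (dMat n) := by
  refine Matrix.ext fun μ ν => ?_
  rw [mul_scalar_apply, scalar_mul_apply]
  have h (a b : Fin n) (c : ℝ) : Commute (c • dLin a b) (dLin μ ν) :=
    (dLin_commute a b μ ν).smul_left c
  exact (((((h _ _ _).sub_left (h _ _ _)).add_left (h _ _ _)).sub_left (h _ _ _)).smul_left
    _).neg_left

theorem sum_kLin_skewUnit (α β : Fin n) :
    ∑ θ, ∑ τ, Matrix.scalar (Fin n) (-kLin α β θ τ) * skewUnit θ τ =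
      innerAd ℝ (dMat n) (skewUnit α β) := by
  ext1 μ ρ
  simp only [innerAd_apply, Matrix.sum_apply, scalar_mul_apply, Matrix.sub_apply]
  simp only [Matrix.mul_apply, skewUnit, dMat, Matrix.of_apply, mul_smul_comm, smul_mul_assoc,
    mul_one, one_mul]
  exact sum_skew_smul dLin dLin_swap α β μ ρ

theorem negKpow_eq (k : ℕ) (α β μ ρ : Fin n) (p : PolyH n) :
    negKpow k α β μ ρ p = (1/2 : ℝ) • ((innerAd ℝ (dMat n) ^ k) (skewUnit α β) μ ρ) p := by
  induction k generalizing α β with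
  | zero => simp [negKpow, skewUnit, mul_smul]
  | succ k ih =>
    rw [pow_succ, Module.End.mul_apply, ← sum_kLin_skewUnit]
    simp only [map_sum, innerAd_pow_mul_of_commute (scalar_kLin_commute_dMat _ _ _ _),
      Matrix.sum_apply, scalar_mul_apply, LinearMap.sum_apply,
      Module.End.mul_apply, LinearMap.neg_apply, Finset.smul_sum]
    simp [negKpow, ih, ← kLin_apply]

theorem negKpow_swap (k : ℕ) (α β μ ρ : Fin n) (p : PolyH n) :
    negKpow k α β ρ μ p = -negKpow k α β μ ρ p := by
  induction k generalizing α β with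
  | zero => simp only [negKpow, ← neg_smul]; congr 1; ring
  | succ k ih => simp [negKpow, ih _ _, ← kLin_apply]

theorem dop_mem_pderivFiltration {d : ℕ} {p : PolyH n} (hp : p ∈ pderivFiltration (d + 1))
    (μ ν : Fin n) : dop μ ν p ∈ pderivFiltration d := by
  rw [mem_pderivFiltration_succ] at hp
  unfold dop
  split_ifs
  · exact hp _
  · exact neg_mem (hp _)
  · exact zero_mem _

theorem Kop_mem_pderivFiltration {d : ℕ} {p : PolyH n} (hp : p ∈ pderivFiltration (d + 1))
    (μ ν α β : Fin n) : Kop μ ν α β p ∈ pderivFiltration d := by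
  have h (c : ℝ) (a b : Fin n) : c • dop a b p ∈ pderivFiltration d :=
    Submodule.smul_mem _ _ (dop_mem_pderivFiltration hp a b)
  exact Submodule.smul_mem _ _ (sub_mem (add_mem (sub_mem (h _ _ _) (h _ _ _)) (h _ _ _)) (h _ _ _))

theorem dmatpow_mem_pderivFiltration (m : ℕ) {d : ℕ} {p : PolyH n}
    (hp : p ∈ pderivFiltration (d + m)) (μ ν : Fin n) : dmatpow m μ ν p ∈ pderivFiltration d := by
  induction m generalizing ν p with
  | zero => exact Submodule.smul_mem _ _ hp
  | succ m ih => exact sum_mem fun α _ => ih (dop_mem_pderivFiltration hp α ν) α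

theorem negKpow_mem_pderivFiltration (k : ℕ) {d : ℕ} {p : PolyH n}
    (hp : p ∈ pderivFiltration (d + k)) (μ ν α β : Fin n) :
    negKpow k μ ν α β p ∈ pderivFiltration d := by
  induction k generalizing μ ν d with
  | zero => exact Submodule.smul_mem _ _ hp
  | succ k ih =>
    refine sum_mem fun θ _ => sum_mem fun τ _ => neg_mem <|
      Kop_mem_pderivFiltration (ih ?_ θ τ) _ _ _ _
    rwa [add_right_comm]

theorem negKpow_dmatpow_eq_zero {N k l : ℕ} {p : PolyH n} (hp : p ∈ pderivFiltration N)
    (h : N ≤ k + l) (α β μ ρ ν σ : Fin n) : negKpow k α β μ ρ (dmatpow l ν σ p) = 0 := by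
  have hd : dmatpow l ν σ p ∈ pderivFiltration (0 + k) := by
    refine dmatpow_mem_pderivFiltration l (pderivFiltration_mono ?_ hp) _ _
    omega
  exact negKpow_mem_pderivFiltration k hd _ _ _ _

theorem expD_eq_sum {N : ℕ} {p : PolyH n} (hp : p ∈ pderivFiltration N) (μ ν : Fin n) :
    expD μ ν p = ∑ m ∈ Finset.range N, ((m.factorial : ℝ))⁻¹ • dmatpow m μ ν p := by
  refine finsum_eq_sum_of_support_subset _ fun m hm => ?_
  by_contra hmN
  have hNm : N ≤ 0 + m := by simpa using hmN
  have h0 : dmatpow m μ ν p = 0 :=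
    dmatpow_mem_pderivFiltration m (pderivFiltration_mono hNm hp) μ ν
  exact hm (by simp [h0])

theorem commutator_dmatpow_succ (N : ℕ) (α β ρ σ : Fin n) (p : PolyH n) :
    xv α β * dmatpow (N + 1) ρ σ p - dmatpow (N + 1) ρ σ (xv α β * p) =
      (2 : ℝ) • ∑ μ, ∑ k ∈ Finset.range (N + 1),
        ((N + 1).choose (k + 1) : ℝ) • negKpow k α β μ ρ (dmatpow (N - k) μ σ p) := by
  have h := pow_succ_commutator_eq_sum_innerAd (R := ℝ) (dMat n)
    (Matrix.scalar (Fin n) (LinearMap.mulLeft ℝ (xv α β))) N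
  rw [dMat_commutator_scalar] at h
  have h' := congrArg (fun M => M ρ σ p) h
  simp only [Matrix.sub_apply, mul_scalar_apply, scalar_mul_apply, LinearMap.sub_apply,
    Module.End.mul_apply, LinearMap.mulLeft_apply, Matrix.sum_apply, LinearMap.sum_apply,
    Matrix.smul_apply, LinearMap.smul_apply, ← dmatpow_eq] at h'
  simp only [Matrix.mul_apply, LinearMap.sum_apply, Module.End.mul_apply, ← dmatpow_eq] at h'
  rw [← neg_sub, h', Finset.sum_comm, Finset.smul_sum, ← Finset.sum_neg_distrib]
  refine Finset.sum_congr rfl fun k _ => ?_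
  rw [Finset.smul_sum, Finset.smul_sum, ← Finset.sum_neg_distrib]
  refine Finset.sum_congr rfl fun μ _ => ?_
  rw [negKpow_swap, negKpow_eq, smul_neg, smul_neg, smul_comm, smul_smul,
    ← Nat.cast_smul_eq_nsmul ℝ]
  module

theorem sum_negKpow_expD {N : ℕ} {p : PolyH n} (hp : p ∈ pderivFiltration N)
    (α β μ ρ σ : Fin n) :
    ∑ᶠ k : ℕ, (((k+1).factorial : ℝ))⁻¹ • negKpow k α β μ ρ (expD μ σ p) =
      ∑ k ∈ Finset.range N, ∑ l ∈ Finset.range N,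
        ((((k+1).factorial : ℝ))⁻¹ * ((l.factorial : ℝ))⁻¹) •
          negKpow k α β μ ρ (dmatpow l μ σ p) := by
  have hterm (k : ℕ) : (((k+1).factorial : ℝ))⁻¹ • negKpow k α β μ ρ (expD μ σ p) =
      ∑ l ∈ Finset.range N, ((((k+1).factorial : ℝ))⁻¹ * ((l.factorial : ℝ))⁻¹) •
        negKpow k α β μ ρ (dmatpow l μ σ p) := by
    simp only [expD_eq_sum hp, negKpow_eq, map_sum, map_smul, Finset.smul_sum, mul_smul]
    refine Finset.sum_congr rfl fun l _ => ?_
    rw [smul_comm (1/2 : ℝ)]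
  rw [finsum_congr hterm]
  refine finsum_eq_sum_of_support_subset _ fun k hk => ?_
  by_contra hkN
  refine hk (Finset.sum_eq_zero fun l _ => ?_)
  have hNk : N ≤ k + l := by
    have : N ≤ k := by simpa using hkN
    omega
  rw [negKpow_dmatpow_eq_zero hp hNk, smul_zero]

end Operators

/-- `[x_{αβ}, (e^∂)_{ρσ}] = 2 Σ_μ Σ_{k≥1} (1/k!)((-K)^{k-1})_{(αβ)(μρ)} ∘ (e^∂)_{μσ}`. -/
theorem statement15 (n : ℕ) (hn : 2 ≤ n) (α β ρ σ : Fin n) :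
    xop α β ∘ expD ρ σ - expD ρ σ ∘ xop α β
      = (2 : ℝ) • fun p =>
          ∑ μ, ∑ᶠ k : ℕ, (((k+1).factorial : ℝ))⁻¹ • negKpow k α β μ ρ (expD μ σ p) := by
  funext p
  obtain ⟨d, hd⟩ := exists_mem_pderivFiltration p
  obtain ⟨e, he⟩ := exists_mem_pderivFiltration (xv α β * p)
  obtain ⟨N, hN, hN'⟩ : ∃ N, p ∈ pderivFiltration N ∧ xv α β * p ∈ pderivFiltration (N + 1) :=
    ⟨max d e, pderivFiltration_mono (le_max_left _ _) hd,
      pderivFiltration_mono ((le_max_right d e).trans (Nat.le_succ _)) he⟩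
  have hzero : xv α β * dmatpow 0 ρ σ p - dmatpow 0 ρ σ (xv α β * p) = 0 := by
    simp [dmatpow]
  simp only [Pi.sub_apply, Pi.smul_apply, Function.comp_apply, xop, sum_negKpow_expD hN]
  rw [expD_eq_sum (pderivFiltration_mono (Nat.le_succ N) hN), expD_eq_sum hN', Finset.mul_sum,
    ← Finset.sum_sub_distrib]
  simp only [mul_smul_comm, ← smul_sub]
  rw [Finset.sum_range_succ', hzero, smul_zero, add_zero]
  simp only [commutator_dmatpow_succ, smul_comm _ (2 : ℝ), ← Finset.smul_sum]
  congr 1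
  simp only [Finset.smul_sum]
  rw [Finset.sum_comm]
  refine Finset.sum_congr rfl fun μ _ => ?_
  rw [← sum_range_antidiagonal_eq_of_vanishing N
    (fun k l => ((((k+1).factorial : ℝ))⁻¹ * ((l.factorial : ℝ))⁻¹) •
      negKpow k α β μ ρ (dmatpow l μ σ p))
    fun k l h => by rw [negKpow_dmatpow_eq_zero hN h, smul_zero]]
  refine Finset.sum_congr rfl fun m _ => Finset.sum_congr rfl fun k hk => ?_
  have hkm : k + 1 ≤ m + 1 := Finset.mem_range.1 hk
  rw [smul_smul, Nat.cast_choose ℝ hkm, Nat.add_sub_add_right]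
  congr 1
  field_simp
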